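/- Let f : ℝ² → ℝ be defined by f(x, y) := x/√(y² + 1). Then K∞(f) = ∅; that is, there is no y ∈ ℝ and no sequence (xᵏ, yᵏ) ∈ ℝ² with ‖(xᵏ, yᵏ)‖ → +∞, f(xᵏ, yᵏ) → y, and ‖(xᵏ, yᵏ)‖·‖∇f(xᵏ, yᵏ)‖ → 0. -/

import Mathlib

open Filter Metric Real

/-- The set of asymptotic critical values of `f`. -/
def Kinf {n : ℕ} (f : EuclideanSpace ℝ (Fin n) → ℝ) : Set ℝ :=
  {y | ∃ x : ℕ → EuclideanSpace ℝ (Fin n),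
    Tendsto (fun k => ‖x k‖) atTop atTop ∧
    Tendsto (fun k => f (x k)) atTop (nhds y) ∧
    Tendsto (fun k => ‖x k‖ * ‖gradient f (x k)‖) atTop (nhds 0)}

theorem differentiableAt_div_sqrt_sq_add_one (p : EuclideanSpace ℝ (Fin 2)) :
    DifferentiableAt ℝ
      (fun p : EuclideanSpace ℝ (Fin 2) => p 0 / Real.sqrt ((p 1) ^ 2 + 1)) p := by
  have h0 : DifferentiableAt ℝ (fun p : EuclideanSpace ℝ (Fin 2) => p 0) p := by fun_prop
  have h1 : DifferentiableAt ℝ (fun p : EuclideanSpace ℝ (Fin 2) => (p 1) ^ 2 + 1) p := by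
    fun_prop
  have hpos : 0 < (p 1) ^ 2 + 1 := by positivity
  simp only [div_eq_mul_inv]
  exact h0.mul ((h1.sqrt hpos.ne').fun_inv (Real.sqrt_pos.2 hpos).ne')

theorem inv_sqrt_le_norm_gradient (p : EuclideanSpace ℝ (Fin 2)) :
    (Real.sqrt ((p 1) ^ 2 + 1))⁻¹ ≤
      ‖gradient (fun p : EuclideanSpace ℝ (Fin 2) => p 0 / Real.sqrt ((p 1) ^ 2 + 1)) p‖ := by
  set f := fun p : EuclideanSpace ℝ (Fin 2) => p 0 / Real.sqrt ((p 1) ^ 2 + 1) with hf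
  set e : EuclideanSpace ℝ (Fin 2) := EuclideanSpace.single 0 1 with he
  have hgrad : HasLineDerivAt ℝ f (inner ℝ (gradient f p) e) p e := by
    have h := (differentiableAt_div_sqrt_sq_add_one p).hasGradientAt.hasFDerivAt.hasLineDerivAt e
    simpa using h
  have hline : HasLineDerivAt ℝ f (Real.sqrt ((p 1) ^ 2 + 1))⁻¹ p e := by
    have h : HasDerivAt (fun t : ℝ => (p 0 + t) / Real.sqrt ((p 1) ^ 2 + 1))
        (1 / Real.sqrt ((p 1) ^ 2 + 1)) 0 :=
      ((hasDerivAt_id (0 : ℝ)).const_add (p 0)).div_const _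
    simpa [HasLineDerivAt, hf, he] using h
  rw [hline.unique hgrad]
  calc inner ℝ (gradient f p) e ≤ ‖gradient f p‖ * ‖e‖ := real_inner_le_norm _ _
    _ = ‖gradient f p‖ := by simp [he]

/-- For `f(x,y) = x / √(y² + 1)`, the set of asymptotic critical values is
empty. -/
theorem Kinf_empty_example :
    ∀ (f : EuclideanSpace ℝ (Fin 2) → ℝ),
      (f = fun p => p 0 / Real.sqrt ((p 1) ^ 2 + 1)) →
      Kinf f = ∅ := by
  rintro f rfl
  rw [Set.eq_empty_iff_forall_notMem]
  rintro y ⟨x, hx, -, hgrad⟩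
  obtain ⟨k, hk, hsmall⟩ := ((hx.eventually_ge_atTop 1).and
    (hgrad.eventually (gt_mem_nhds (show (0 : ℝ) < 1 / 2 by norm_num)))).exists
  have hpos : 0 < Real.sqrt ((x k 1) ^ 2 + 1) := Real.sqrt_pos.2 (by positivity)
  have hcoord : (x k 1) ^ 2 ≤ ‖x k‖ ^ 2 := by
    rw [EuclideanSpace.norm_sq_eq, Fin.sum_univ_two]
    simp only [Real.norm_eq_abs, sq_abs]
    nlinarith [sq_nonneg (x k 0)]
  have hsqrt : Real.sqrt ((x k 1) ^ 2 + 1) ≤ 2 * ‖x k‖ :=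
    Real.sqrt_le_iff.2 ⟨by positivity, by nlinarith⟩
  have hlower : 1 / 2 ≤ ‖x k‖ * (Real.sqrt ((x k 1) ^ 2 + 1))⁻¹ := by
    rw [← div_eq_mul_inv, le_div_iff₀ hpos]
    linarith
  exact absurd hsmall (not_lt.2 (hlower.trans
    (mul_le_mul_of_nonneg_left (inv_sqrt_le_norm_gradient (x k)) (norm_nonneg _))))
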